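/- Let r > 0 and L ≥ 0, and let u be a smooth function on the exterior region {p ∈ ℝ² : ‖p‖ > r} satisfying the minimal surface equation there, with ‖∇u(p)‖ ≤ L for all p and u(p) ≤ 0 for all p. Then the gradient of u tends to zero at infinity: ‖∇u(p)‖ → 0 as ‖p‖ → ∞. That is, the graph of u, a minimal surface contained in the halfspace {z ≤ 0}, is horizontal at infinity. -/

import Mathlib

noncomputable section

/-- The partial derivative `∂ᵢ u` of a function `u : ℝ² → ℝ`. -/
noncomputable def pderiv2 (u : EuclideanSpace ℝ (Fin 2) → ℝ) (i : Fin 2)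
    (x : EuclideanSpace ℝ (Fin 2)) : ℝ :=
  fderiv ℝ u x (EuclideanSpace.single i 1)

/-- `u` satisfies the minimal surface equation on `U`: it is `C²` on `U` and
`(1 + (∂₂u)²)∂₁₁u − 2 ∂₁u ∂₂u ∂₁₂u + (1 + (∂₁u)²)∂₂₂u = 0` on `U`. -/
def MinimalSurfaceEquation (u : EuclideanSpace ℝ (Fin 2) → ℝ)
    (U : Set (EuclideanSpace ℝ (Fin 2))) : Prop :=
  ContDiffOn ℝ 2 u U ∧ ∀ x ∈ U,
    (1 + (pderiv2 u 1 x) ^ 2) * pderiv2 (pderiv2 u 0) 0 x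
      - 2 * pderiv2 u 0 x * pderiv2 u 1 x * pderiv2 (pderiv2 u 1) 0 x
      + (1 + (pderiv2 u 0 x) ^ 2) * pderiv2 (pderiv2 u 1) 1 x = 0

open MeasureTheory Set Filter Topology Metric

local notation "ℝ²" => EuclideanSpace ℝ (Fin 2)

/-- `w` is a `C¹` function on `U` with a divergence-free `C¹` flux `X` which is dominated by the
gradient of `w` and satisfies the coercivity estimate `c ‖∇w‖² ≤ ⟨∇w, X⟩`. -/
structure IsDivergenceFormSolution (c : ℝ) (U : Set ℝ²) (w : ℝ² → ℝ) (X : ℝ² → ℝ²) : Prop where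
  isOpen : IsOpen U
  pos : 0 < c
  contDiffOn : ContDiffOn ℝ 1 w U
  contDiffOn_flux : ContDiffOn ℝ 1 X U
  div_eq_zero : ∀ x ∈ U, ∑ i, pderiv2 (fun y => X y i) i x = 0
  norm_flux_le : ∀ x ∈ U, ‖X x‖ ≤ ‖fderiv ℝ w x‖
  coercive : ∀ x ∈ U, c * ‖fderiv ℝ w x‖ ^ 2 ≤ fderiv ℝ w x (X x)

lemma clm_apply_eq_sum_single (f : ℝ² →L[ℝ] ℝ) (v : ℝ²) :
    f v = ∑ i, f (EuclideanSpace.single i 1) * v i := by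
  conv_lhs => rw [← (EuclideanSpace.basisFun (Fin 2) ℝ).sum_repr v]
  simp [mul_comm]

lemma tsupport_clm_apply_subset {D : ℝ² → ℝ² →L[ℝ] ℝ} {X : ℝ² → ℝ²} :
    tsupport (fun x => D x (X x)) ⊆ tsupport D := by
  refine closure_mono fun x hx hD => hx ?_
  simp [hD]

lemma contDiff_of_forall_mem_tsupport {f : ℝ² → ℝ}
    (hf : ∀ x ∈ tsupport f, ContDiffAt ℝ 1 f x) : ContDiff ℝ 1 f := by
  refine contDiff_iff_contDiffAt.2 fun x => ?_
  by_cases hx : x ∈ tsupport f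
  · exact hf x hx
  · exact contDiffAt_const.congr_of_eventuallyEq (notMem_tsupport_iff_eventuallyEq.1 hx)

lemma ContDiffOn.continuousOn_pderiv2 {U : Set ℝ²} (hU : IsOpen U) {f : ℝ² → ℝ}
    (hf : ContDiffOn ℝ 1 f U) (i : Fin 2) : ContinuousOn (pderiv2 f i) U :=
  (hf.continuousOn_fderiv_of_isOpen hU le_rfl).clm_apply continuousOn_const

namespace IsDivergenceFormSolution

variable {c : ℝ} {U : Set ℝ²} {w : ℝ² → ℝ} {X : ℝ² → ℝ²}

lemma neg (h : IsDivergenceFormSolution c U w X) :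
    IsDivergenceFormSolution c U (-w) (-X) where
  isOpen := h.isOpen
  pos := h.pos
  contDiffOn := h.contDiffOn.neg
  contDiffOn_flux := h.contDiffOn_flux.neg
  div_eq_zero x hx := by
    have := h.div_eq_zero x hx
    have key : ∀ i, pderiv2 (fun y => (-X) y i) i x = - pderiv2 (fun y => X y i) i x := by
      intro i
      simp [pderiv2]
    rw [Finset.sum_congr rfl fun i _ => key i, Finset.sum_neg_distrib, this, neg_zero]
  norm_flux_le x hx := by simpa [fderiv_neg] using h.norm_flux_le x hx
  coercive x hx := by simpa [fderiv_neg] using h.coercive x hx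

lemma contDiffOn_flux_apply (h : IsDivergenceFormSolution c U w X) (i : Fin 2) :
    ContDiffOn ℝ 1 (fun y => X y i) U :=
  (contDiffOn_euclidean.1 h.contDiffOn_flux) i

/-- The weak formulation of `div X = 0`. -/
lemma integral_fderiv_flux_eq_zero (h : IsDivergenceFormSolution c U w X) {ζ : ℝ² → ℝ}
    (hζ : ContDiff ℝ 1 ζ) (hc : HasCompactSupport ζ) (hs : tsupport ζ ⊆ U) :
    ∫ x, fderiv ℝ ζ x (X x) = 0 := by
  have hdζ : ∀ i, Continuous (pderiv2 ζ i) := fun i =>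
    (hζ.continuous_fderiv one_ne_zero).clm_apply continuous_const
  have hts : ∀ i, tsupport (pderiv2 ζ i) ⊆ tsupport ζ := fun i => tsupport_fderiv_apply_subset ℝ _
  have int1 : ∀ i, Integrable (fun x => pderiv2 ζ i x * X x i) := by
    intro i
    have ht : tsupport (fun x => pderiv2 ζ i x * X x i) ⊆ tsupport ζ :=
      (tsupport_mul_subset_left).trans (hts i)
    refine Continuous.integrable_of_hasCompactSupport ?_
      (hc.of_isClosed_subset (isClosed_tsupport _) ht)
    refine continuous_of_tsupport fun x hx => ?_
    exact (hdζ i).continuousAt.mul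
      ((h.contDiffOn_flux_apply i).continuousOn.continuousAt (h.isOpen.mem_nhds (hs (ht hx))))
  have int2 : ∀ i, Integrable (fun x => ζ x * pderiv2 (fun y => X y i) i x) := by
    intro i
    have ht : tsupport (fun x => ζ x * pderiv2 (fun y => X y i) i x) ⊆ tsupport ζ :=
      tsupport_mul_subset_left
    refine Continuous.integrable_of_hasCompactSupport ?_
      (hc.of_isClosed_subset (isClosed_tsupport _) ht)
    refine continuous_of_tsupport fun x hx => ?_
    exact hζ.continuous.continuousAt.mul
      (((h.contDiffOn_flux_apply i).continuousOn_pderiv2 h.isOpen i).continuousAt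
        (h.isOpen.mem_nhds (hs (ht hx))))
  have int3 : ∀ i, Integrable (fun x => ζ x * X x i) := by
    intro i
    have ht : tsupport (fun x => ζ x * X x i) ⊆ tsupport ζ := tsupport_mul_subset_left
    refine Continuous.integrable_of_hasCompactSupport ?_
      (hc.of_isClosed_subset (isClosed_tsupport _) ht)
    refine continuous_of_tsupport fun x hx => ?_
    exact hζ.continuous.continuousAt.mul
      ((h.contDiffOn_flux_apply i).continuousOn.continuousAt (h.isOpen.mem_nhds (hs (ht hx))))
  have hparts : ∀ i, ∫ x, pderiv2 ζ i x * X x i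
      = - ∫ x, ζ x * pderiv2 (fun y => X y i) i x := by
    intro i
    have := integral_mul_fderiv_eq_neg_fderiv_mul_of_integrable (μ := volume)
      (f := ζ) (g := fun y => X y i) (v := EuclideanSpace.single i 1) (int1 i) (int2 i) (int3 i)
      (fun x _ => hζ.differentiable one_ne_zero x)
      (fun x hx => ((h.contDiffOn_flux_apply i).differentiableOn one_ne_zero).differentiableAt
        (h.isOpen.mem_nhds (hs hx)))
    simp only [pderiv2]
    rw [this, neg_neg]
  calc ∫ x, fderiv ℝ ζ x (X x) = ∫ x, ∑ i, pderiv2 ζ i x * X x i :=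
        integral_congr_ae (.of_forall fun x => clm_apply_eq_sum_single _ _)
    _ = ∑ i, ∫ x, pderiv2 ζ i x * X x i := integral_finsetSum _ fun i _ => int1 i
    _ = - ∫ x, ∑ i, ζ x * pderiv2 (fun y => X y i) i x := by
        rw [integral_finsetSum _ fun i _ => int2 i, ← Finset.sum_neg_distrib]
        exact Finset.sum_congr rfl fun i _ => hparts i
    _ = 0 := by
        rw [neg_eq_zero, ← integral_zero ℝ² ℝ]
        refine integral_congr_ae (.of_forall fun x => ?_)
        simp only [← Finset.mul_sum]
        by_cases hx : x ∈ tsupport ζ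
        · rw [h.div_eq_zero x (hs hx), mul_zero]
        · rw [image_eq_zero_of_notMem_tsupport hx, zero_mul]

/-- Caccioppoli's inequality for bounded solutions. -/
lemma integral_sq_mul_norm_fderiv_sq_le (h : IsDivergenceFormSolution c U w X) {L : ℝ}
    (hL : 0 ≤ L) (hw : ∀ x ∈ U, |w x| ≤ L) {φ : ℝ² → ℝ} (hφ : ContDiff ℝ 1 φ)
    (hc : HasCompactSupport φ) (hs : tsupport φ ⊆ U) :
    Integrable (fun x => φ x ^ 2 * ‖fderiv ℝ w x‖ ^ 2) ∧
    ∫ x, φ x ^ 2 * ‖fderiv ℝ w x‖ ^ 2 ≤ 4 * L ^ 2 / c ^ 2 * ∫ x, ‖fderiv ℝ φ x‖ ^ 2 := by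
  have hcpos := h.pos
  have hdw := h.contDiffOn.continuousOn_fderiv_of_isOpen h.isOpen le_rfl
  have hdiffw : ∀ x ∈ U, ContDiffAt ℝ 1 w x := fun x hx =>
    h.contDiffOn.contDiffAt (h.isOpen.mem_nhds hx)
  set ζ : ℝ² → ℝ := fun x => φ x ^ 2 * w x with hζdef
  have hζs : tsupport ζ ⊆ tsupport φ := by
    refine closure_mono fun x hx hφx => hx ?_
    simp [hζdef, hφx]
  have hζ : ContDiff ℝ 1 ζ := contDiff_of_forall_mem_tsupport fun x hx =>
    (hφ.contDiffAt.pow 2).mul (hdiffw x (hs (hζs hx)))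
  have hζc : HasCompactSupport ζ := hc.of_isClosed_subset (isClosed_tsupport _) hζs
  have hzero := h.integral_fderiv_flux_eq_zero hζ hζc (hζs.trans hs)
  have int1 : Integrable (fun x => φ x ^ 2 * ‖fderiv ℝ w x‖ ^ 2) := by
    have ht : tsupport (fun x => φ x ^ 2 * ‖fderiv ℝ w x‖ ^ 2) ⊆ tsupport φ := by
      refine closure_mono fun x hx hφx => hx ?_
      simp [hφx]
    refine Continuous.integrable_of_hasCompactSupport ?_
      (hc.of_isClosed_subset (isClosed_tsupport _) ht)
    refine continuous_of_tsupport fun x hx => ?_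
    exact (hφ.continuous.continuousAt.pow 2).mul
      ((hdw.continuousAt (h.isOpen.mem_nhds (hs (ht hx)))).norm.pow 2)
  have int2 : Integrable (fun x => ‖fderiv ℝ φ x‖ ^ 2) := by
    refine Continuous.integrable_of_hasCompactSupport
      ((hφ.continuous_fderiv one_ne_zero).norm.pow 2) ?_
    refine (hc.fderiv ℝ).mono' fun x hx => subset_tsupport _ fun h0 => hx ?_
    simp [h0]
  have int3 : Integrable (fun x => fderiv ℝ ζ x (X x)) := by
    have ht : tsupport (fun x => fderiv ℝ ζ x (X x)) ⊆ tsupport ζ :=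
      tsupport_clm_apply_subset.trans (tsupport_fderiv_subset ℝ)
    refine Continuous.integrable_of_hasCompactSupport ?_
      (hζc.of_isClosed_subset (isClosed_tsupport _) ht)
    refine continuous_of_tsupport fun x hx => ?_
    exact (hζ.continuous_fderiv one_ne_zero).continuousAt.clm_apply
      (h.contDiffOn_flux.continuousOn.continuousAt (h.isOpen.mem_nhds (hs (hζs (ht hx)))))
  refine ⟨int1, ?_⟩
  have hpt : ∀ x, c / 2 * (φ x ^ 2 * ‖fderiv ℝ w x‖ ^ 2)
      ≤ 2 * L ^ 2 / c * ‖fderiv ℝ φ x‖ ^ 2 + fderiv ℝ ζ x (X x) := by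
    intro x
    by_cases hx : x ∈ tsupport φ
    · have hxU := hs hx
      have hd : fderiv ℝ ζ x (X x)
          = φ x ^ 2 * fderiv ℝ w x (X x) + 2 * φ x * w x * fderiv ℝ φ x (X x) := by
        have h1 : HasFDerivAt ζ _ x :=
          ((hφ.differentiable one_ne_zero x).hasFDerivAt.pow 2).mul
            ((hdiffw x hxU).differentiableAt one_ne_zero).hasFDerivAt
        rw [h1.fderiv]
        simp
        ring
      have hco := h.coercive x hxU
      have hb : |fderiv ℝ φ x (X x)| ≤ ‖fderiv ℝ φ x‖ * ‖fderiv ℝ w x‖ :=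
        ((fderiv ℝ φ x).le_opNorm (X x)).trans
          (mul_le_mul_of_nonneg_left (h.norm_flux_le x hxU) (norm_nonneg _))
      have hcross : |2 * φ x * w x * fderiv ℝ φ x (X x)|
          ≤ 2 * |φ x| * L * (‖fderiv ℝ φ x‖ * ‖fderiv ℝ w x‖) := by
        rw [abs_mul, abs_mul, abs_mul, abs_two]
        have := hw x hxU
        gcongr
      have hcross' := neg_le_of_abs_le hcross
      set a := ‖fderiv ℝ w x‖
      set b := ‖fderiv ℝ φ x‖
      have hsq : φ x ^ 2 = |φ x| ^ 2 := (sq_abs _).symm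
      have hamgm : 2 * |φ x| * L * (b * a)
          ≤ c / 2 * (|φ x| ^ 2 * a ^ 2) + 2 * L ^ 2 / c * b ^ 2 := by
        have : c / 2 * (|φ x| ^ 2 * a ^ 2) + 2 * L ^ 2 / c * b ^ 2 - 2 * |φ x| * L * (b * a)
            = (c * |φ x| * a - 2 * L * b) ^ 2 / (2 * c) := by
          field_simp
          ring
        have h2 : 0 ≤ (c * |φ x| * a - 2 * L * b) ^ 2 / (2 * c) := by positivity
        linarith
      have := mul_le_mul_of_nonneg_left hco (sq_nonneg (φ x))
      rw [hd]
      rw [← hsq] at hamgm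
      nlinarith
    · have h0 : fderiv ℝ ζ x = 0 := by
        by_contra hne
        exact hx (hζs (tsupport_fderiv_subset ℝ (subset_tsupport _ hne)))
      rw [image_eq_zero_of_notMem_tsupport hx, h0]
      have : 0 ≤ 2 * L ^ 2 / c * ‖fderiv ℝ φ x‖ ^ 2 := by positivity
      simpa using this
  have hint := integral_mono (int1.const_mul (c / 2)) ((int2.const_mul (2 * L ^ 2 / c)).add int3)
    hpt
  simp only [Pi.add_apply] at hint
  rw [integral_add (int2.const_mul _) int3, hzero, integral_const_mul, integral_const_mul,
    add_zero] at hint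
  calc _ = 2 / c * (c / 2 * ∫ x, φ x ^ 2 * ‖fderiv ℝ w x‖ ^ 2) := by field_simp
    _ ≤ 2 / c * (2 * L ^ 2 / c * ∫ x, ‖fderiv ℝ φ x‖ ^ 2) := by gcongr
    _ = _ := by ring

/-- The weak maximum principle on discs. -/
lemma le_of_le_on_sphere (h : IsDivergenceFormSolution c U w X) {p : ℝ²} {t M : ℝ}
    (hU : closedBall p t ⊆ U) (hM : ∀ x ∈ sphere p t, w x ≤ M) :
    ∀ x ∈ closedBall p t, w x ≤ M := by
  intro x₀ hx₀
  refine le_of_forall_pos_lt_add fun ε hε => ?_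
  by_contra! hlt
  obtain ⟨η, hη, hηdef⟩ : ∃ η : ℝ → ℝ, ContDiff ℝ 1 η ∧ η = expNegInvGlue :=
    ⟨_, expNegInvGlue.contDiff (n := 1), rfl⟩
  have hηm : Monotone η := hηdef ▸ expNegInvGlue.monotone
  have hη0 : ∀ s, s ≤ 0 → η s = 0 := fun s hs => hηdef ▸ expNegInvGlue.zero_of_nonpos hs
  have hηpos : ∀ s, 0 < s → 0 < η s := fun s hs => hηdef ▸ expNegInvGlue.pos_of_pos hs
  set K : Set ℝ² := {x ∈ closedBall p t | M + ε / 2 ≤ w x} with hK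
  have hwc : ContinuousOn w (closedBall p t) := h.contDiffOn.continuousOn.mono hU
  have hKclosed : IsClosed K := by
    have := hwc.preimage_isClosed_of_isClosed isClosed_closedBall (isClosed_Ici (a := M + ε / 2))
    exact this
  set ζ : ℝ² → ℝ := (closedBall p t).indicator (fun x => η (w x - (M + ε / 2))) with hζdef
  have hζs : tsupport ζ ⊆ K := by
    refine closure_minimal (fun x hx => ?_) hKclosed
    have hxb : x ∈ closedBall p t := by
      by_contra hn
      exact hx (indicator_of_notMem hn _)
    refine ⟨hxb, ?_⟩
    by_contra! hn
    refine hx ?_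
    rw [hζdef, indicator_of_mem hxb]
    exact hη0 _ (by linarith)
  have hKball : K ⊆ ball p t := by
    rintro x ⟨hxb, hxw⟩
    rcases (mem_closedBall.1 hxb).lt_or_eq with h1 | h1
    · exact h1
    · have := hM x h1
      linarith
  have hKU : K ⊆ U := fun x hx => hU hx.1
  have hloc : ∀ x ∈ ball p t, ζ =ᶠ[𝓝 x] fun y => η (w y - (M + ε / 2)) := fun x hx => by
    filter_upwards [isOpen_ball.mem_nhds hx] with y hy
    rw [hζdef, indicator_of_mem (ball_subset_closedBall hy)]
  have hζ : ContDiff ℝ 1 ζ := contDiff_of_forall_mem_tsupport fun x hx => by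
    refine ContDiffAt.congr_of_eventuallyEq ?_ (hloc x (hKball (hζs hx)))
    exact hη.contDiffAt.comp x
      ((h.contDiffOn.contDiffAt (h.isOpen.mem_nhds (hKU (hζs hx)))).sub contDiffAt_const)
  have hζc : HasCompactSupport ζ :=
    (isCompact_closedBall p t).of_isClosed_subset (isClosed_tsupport _) (fun x hx => (hζs hx).1)
  have hfd : ∀ x ∈ K, fderiv ℝ ζ x = deriv η (w x - (M + ε / 2)) • fderiv ℝ w x := fun x hx => by
    rw [(hloc x (hKball hx)).fderiv_eq]
    have h1 : HasFDerivAt w (fderiv ℝ w x) x :=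
      ((h.contDiffOn.contDiffAt (h.isOpen.mem_nhds (hKU hx))).differentiableAt
        one_ne_zero).hasFDerivAt
    exact (((hη.differentiable one_ne_zero _).hasDerivAt).comp_hasFDerivAt x
      (h1.sub_const (M + ε / 2))).fderiv
  have hfd0 : ∀ x, x ∉ K → fderiv ℝ ζ x = 0 := fun x hx => by
    by_contra hne
    exact hx (hζs (tsupport_fderiv_subset ℝ (subset_tsupport _ hne)))
  have hη' : ∀ s, 0 ≤ deriv η s := fun s => hηm.deriv_nonneg
  have hnonneg : ∀ x, 0 ≤ fderiv ℝ ζ x (X x) := fun x => by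
    by_cases hx : x ∈ K
    · rw [hfd x hx]
      have := h.coercive x (hKU hx)
      have h2 : 0 ≤ c * ‖fderiv ℝ w x‖ ^ 2 := mul_nonneg h.pos.le (sq_nonneg _)
      exact mul_nonneg (hη' _) (h2.trans this)
    · simp [hfd0 x hx]
  have ht : tsupport (fun x => fderiv ℝ ζ x (X x)) ⊆ tsupport ζ :=
    tsupport_clm_apply_subset.trans (tsupport_fderiv_subset ℝ)
  have hcont : Continuous (fun x => fderiv ℝ ζ x (X x)) := by
    refine continuous_of_tsupport fun x hx => ?_
    exact (hζ.continuous_fderiv one_ne_zero).continuousAt.clm_apply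
      (h.contDiffOn_flux.continuousOn.continuousAt (h.isOpen.mem_nhds (hKU (hζs (ht hx)))))
  have hint : Integrable (fun x => fderiv ℝ ζ x (X x)) :=
    hcont.integrable_of_hasCompactSupport (hζc.of_isClosed_subset (isClosed_tsupport _) ht)
  have hz : (fun x => fderiv ℝ ζ x (X x)) = 0 := by
    refine (hcont.ae_eq_iff_eq volume continuous_const).1
      ((integral_eq_zero_iff_of_nonneg hnonneg hint).1 ?_)
    exact h.integral_fderiv_flux_eq_zero hζ hζc (hζs.trans hKU)
  have hfz : ∀ x, fderiv ℝ ζ x = 0 := fun x => by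
    by_cases hx : x ∈ K
    · have h1 := congrFun hz x
      simp only [hfd x hx, smul_apply, smul_eq_mul, Pi.zero_apply] at h1
      rw [hfd x hx]
      rcases mul_eq_zero.1 h1 with h2 | h2
      · rw [h2, zero_smul]
      · have h3 := h.coercive x (hKU hx)
        rw [h2] at h3
        have h4 : ‖fderiv ℝ w x‖ ^ 2 = 0 :=
          le_antisymm (by nlinarith [h.pos]) (sq_nonneg _)
        rw [norm_eq_zero.1 (pow_eq_zero_iff two_ne_zero |>.1 h4), smul_zero]
    · exact hfd0 x hx
  have hconst := is_const_of_fderiv_eq_zero (hζ.differentiable one_ne_zero) hfz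
  obtain ⟨y, hy⟩ : ∃ y, y ∉ closedBall p t := by
    by_contra! hall
    exact (isCompact_closedBall p t).ne_univ (eq_univ_of_forall hall)
  have h1 : ζ x₀ = 0 := by rw [hconst x₀ y, hζdef, indicator_of_notMem hy]
  rw [hζdef, indicator_of_mem hx₀] at h1
  exact (hηpos _ (by linarith)).ne' h1

end IsDivergenceFormSolution

/-- The standard isometry from the complex plane onto `ℝ²`. -/
def complexIsometry : ℂ ≃ₗᵢ[ℝ] ℝ² :=
  Complex.orthonormalBasisOneI.repr

lemma lintegral_polar (p : ℝ²) (g : ℝ² → ENNReal) :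
    ∫⁻ x, g x = ∫⁻ q in polarCoord.target,
      ENNReal.ofReal q.1 * g (p + complexIsometry (Complex.polarCoord.symm q)) := by
  rw [← lintegral_add_left_eq_self g p,
    ← (Complex.orthonormalBasisOneI.measurePreserving_repr).lintegral_comp_emb
      (Complex.orthonormalBasisOneI.repr.toHomeomorph.measurableEmbedding),
    ← Complex.lintegral_comp_polarCoord_symm]
  rfl

lemma intervalIntegral_sq_ge {f : ℝ → ℝ} (hf : Continuous f) {a b d : ℝ} (hab : a < b)
    (hd : 0 ≤ d) (h : d ≤ ∫ x in a..b, f x) : d ^ 2 / (b - a) ≤ ∫ x in a..b, f x ^ 2 := by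
  have hba : 0 < b - a := sub_pos.2 hab
  have hc : ∀ g : ℝ → ℝ, Continuous g → IntervalIntegrable g volume a b :=
    fun g hg => hg.intervalIntegrable a b
  set m := d / (b - a)
  have hm : 0 ≤ m := by positivity
  have hmono : ∫ x in a..b, (2 * m * f x - m ^ 2) ≤ ∫ x in a..b, f x ^ 2 :=
    intervalIntegral.integral_mono_on hab.le (hc _ (by fun_prop)) (hc _ (by fun_prop))
      fun x _ => by nlinarith [sq_nonneg (f x - m)]
  rw [intervalIntegral.integral_sub (hc _ (by fun_prop)) (hc _ (by fun_prop)),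
    intervalIntegral.integral_const_mul, intervalIntegral.integral_const, smul_eq_mul] at hmono
  have h1 : 2 * m * d ≤ 2 * m * ∫ x in a..b, f x := by gcongr
  have h2 : d ^ 2 / (b - a) = 2 * m * d - (b - a) * m ^ 2 := by
    simp only [m]
    field_simp
    ring
  linarith

/-- The circle of radius `t` around `p`, parametrised by the angle. -/
def circleParam (p : ℝ²) (t θ : ℝ) : ℝ² := p + complexIsometry (t * Complex.exp (θ * Complex.I))

lemma circleParam_mem_sphere (p : ℝ²) {t : ℝ} (ht : 0 ≤ t) (θ : ℝ) :
    circleParam p t θ ∈ sphere p t := by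
  rw [mem_sphere_iff_norm, circleParam, add_sub_cancel_left, LinearIsometryEquiv.norm_map,
    norm_mul, Complex.norm_exp_ofReal_mul_I, mul_one, Complex.norm_real, Real.norm_of_nonneg ht]

lemma exists_circleParam_eq {p x : ℝ²} {t : ℝ} (hx : x ∈ sphere p t) :
    ∃ θ ∈ Icc (-Real.pi) Real.pi, circleParam p t θ = x := by
  set z := complexIsometry.symm (x - p)
  have hz : ‖z‖ = t := by
    rw [LinearIsometryEquiv.norm_map]
    exact mem_sphere_iff_norm.1 hx
  refine ⟨z.arg, ⟨(Complex.neg_pi_lt_arg z).le, Complex.arg_le_pi z⟩, ?_⟩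
  rw [circleParam, ← hz, Complex.norm_mul_exp_arg_mul_I, LinearIsometryEquiv.apply_symm_apply,
    add_sub_cancel]

lemma hasDerivAt_circleParam (p : ℝ²) (t θ : ℝ) :
    HasDerivAt (circleParam p t)
      (complexIsometry (t * (Complex.exp (θ * Complex.I) * Complex.I))) θ := by
  have h1 : HasDerivAt (fun θ : ℝ => (t : ℂ) * Complex.exp (θ * Complex.I))
      (t * (Complex.exp (θ * Complex.I) * Complex.I)) θ := by
    have h2 : HasDerivAt (fun θ : ℝ => (θ : ℂ) * Complex.I) (1 * Complex.I) θ :=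
      (Complex.ofRealCLM.hasDerivAt (x := θ)).mul_const Complex.I
    simpa using (h2.cexp).const_mul (t : ℂ)
  exact ((complexIsometry.toContinuousLinearEquiv.toContinuousLinearMap.hasFDerivAt).comp_hasDerivAt
    θ h1).const_add p

lemma continuous_circleParam (p : ℝ²) : Continuous fun q : ℝ × ℝ => circleParam p q.1 q.2 := by
  unfold circleParam
  fun_prop

lemma continuous_circleParam_angle (p : ℝ²) (t : ℝ) : Continuous (circleParam p t) := by
  unfold circleParam
  fun_prop

lemma sq_div_le_integral_norm_fderiv_sq_circle {U : Set ℝ²} (hUo : IsOpen U) {w : ℝ² → ℝ}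
    (hw : ContDiffOn ℝ 1 w U) {p : ℝ²} {t d : ℝ} (ht : 0 < t) (hd : 0 ≤ d) (hU : sphere p t ⊆ U)
    {x y : ℝ²} (hx : x ∈ sphere p t) (hy : y ∈ sphere p t) (hxy : d ≤ |w x - w y|) :
    d ^ 2 / (2 * Real.pi * t)
      ≤ ∫ θ in (-Real.pi)..Real.pi, t * ‖fderiv ℝ w (circleParam p t θ)‖ ^ 2 := by
  have hmem : ∀ θ, circleParam p t θ ∈ U := fun θ => hU (circleParam_mem_sphere p ht.le θ)
  have hγ : Continuous (circleParam p t) := continuous_circleParam_angle p t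
  have hdw : Continuous fun θ => fderiv ℝ w (circleParam p t θ) :=
    (hw.continuousOn_fderiv_of_isOpen hUo le_rfl).comp_continuous hγ hmem
  set v : ℝ → ℝ² := fun θ => complexIsometry (t * (Complex.exp (θ * Complex.I) * Complex.I))
  have hv : Continuous v := by fun_prop
  have hvn : ∀ θ, ‖v θ‖ = t := fun θ => by
    simp only [v, LinearIsometryEquiv.norm_map, norm_mul, Complex.norm_exp_ofReal_mul_I,
      Complex.norm_I, mul_one, Complex.norm_real, Real.norm_of_nonneg ht.le]
  have hderiv : ∀ θ, HasDerivAt (fun θ => w (circleParam p t θ))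
      (fderiv ℝ w (circleParam p t θ) (v θ)) θ := fun θ =>
    ((hw.differentiableOn one_ne_zero).differentiableAt
      (hUo.mem_nhds (hmem θ))).hasFDerivAt.comp_hasDerivAt θ (hasDerivAt_circleParam p t θ)
  obtain ⟨α, hα, rfl⟩ := exists_circleParam_eq hx
  obtain ⟨β, hβ, rfl⟩ := exists_circleParam_eq hy
  set h : ℝ → ℝ := fun θ => t * ‖fderiv ℝ w (circleParam p t θ)‖
  have hh : Continuous h := by fun_prop
  have hle : d ≤ ∫ θ in (-Real.pi)..Real.pi, h θ := by
    refine hxy.trans ?_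
    rw [← intervalIntegral.integral_eq_sub_of_hasDerivAt (fun θ _ => hderiv θ)
      ((hdw.clm_apply hv).intervalIntegrable β α)]
    have h1 : |∫ θ in β..α, fderiv ℝ w (circleParam p t θ) (v θ)| ≤ |∫ θ in β..α, h θ| := by
      rw [← Real.norm_eq_abs]
      refine intervalIntegral.norm_integral_le_abs_of_norm_le (.of_forall fun θ => ?_)
        (hh.intervalIntegrable β α)
      refine ((fderiv ℝ w (circleParam p t θ)).le_opNorm (v θ)).trans_eq ?_
      rw [hvn, mul_comm]
    refine h1.trans ((intervalIntegral.abs_integral_mono_interval ?_ (.of_forall fun θ => ?_)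
      (hh.intervalIntegrable _ _)).trans_eq (abs_of_nonneg ?_))
    · have hpi : -Real.pi ≤ Real.pi := by linarith [Real.pi_pos]
      rw [uIoc_of_le hpi]
      exact Ioc_subset_Ioc (le_min hβ.1 hα.1) (max_le hβ.2 hα.2)
    · exact mul_nonneg ht.le (norm_nonneg _)
    · exact intervalIntegral.integral_nonneg (by linarith [Real.pi_pos])
        fun θ _ => mul_nonneg ht.le (norm_nonneg _)
  have hsq := intervalIntegral_sq_ge hh (by linarith [Real.pi_pos]) hd hle
  have heq : ∀ θ, h θ ^ 2 = t * (t * ‖fderiv ℝ w (circleParam p t θ)‖ ^ 2) := fun θ => by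
    simp only [h]
    ring
  simp only [heq, intervalIntegral.integral_const_mul t] at hsq ⊢
  rw [div_le_iff₀ (by linarith [Real.pi_pos])] at hsq
  rw [div_le_iff₀ (by positivity)]
  linarith

/-- The Courant–Lebesgue lemma: a function with small Dirichlet energy on a disc has small
oscillation on some concentric circle. -/
lemma exists_sphere_forall_abs_sub_lt {U : Set ℝ²} (hUo : IsOpen U) {w : ℝ² → ℝ}
    (hw : ContDiffOn ℝ 1 w U) {p : ℝ²} {ρ d : ℝ} (hρ : 0 < ρ) (hd : 0 < d)
    (hU : closedBall p (2 * ρ) ⊆ U)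
    (hE : ∫ x in closedBall p (2 * ρ), ‖fderiv ℝ w x‖ ^ 2 < d ^ 2 / (4 * Real.pi)) :
    ∃ t ∈ Icc ρ (2 * ρ), ∀ x ∈ sphere p t, ∀ y ∈ sphere p t, |w x - w y| < d := by
  by_contra! hcon
  have hpi := Real.pi_pos
  have hdw := hw.continuousOn_fderiv_of_isOpen hUo le_rfl
  set F : ℝ² → ℝ := fun x => ‖fderiv ℝ w x‖ ^ 2
  have hF : ContinuousOn F U := hdw.norm.pow 2
  have hFi : IntegrableOn F (closedBall p (2 * ρ)) :=
    (hF.mono hU).integrableOn_compact (isCompact_closedBall _ _)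
  have hmeas : Measurable fun q : ℝ × ℝ =>
      ENNReal.ofReal (q.1 * (closedBall p (2 * ρ)).indicator F (circleParam p q.1 q.2)) :=
    (measurable_fst.mul ((((measurable_fderiv ℝ w).norm.pow_const 2).indicator
      measurableSet_closedBall).comp (continuous_circleParam p).measurable)).ennreal_ofReal
  have hlow : ENNReal.ofReal (d ^ 2 / (4 * Real.pi)) ≤
      ∫⁻ x in closedBall p (2 * ρ), ENNReal.ofReal (F x) := by
    rw [← lintegral_indicator measurableSet_closedBall, lintegral_polar p]
    calc ENNReal.ofReal (d ^ 2 / (4 * Real.pi))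
        = ∫⁻ t in Icc ρ (2 * ρ), ENNReal.ofReal (d ^ 2 / (4 * Real.pi * ρ)) := by
          rw [setLIntegral_const, Real.volume_Icc, ← ENNReal.ofReal_mul (by positivity)]
          congr 1
          field_simp
          ring
      _ ≤ ∫⁻ t in Icc ρ (2 * ρ), ∫⁻ θ in Ioo (-Real.pi) Real.pi,
            ENNReal.ofReal (t * (closedBall p (2 * ρ)).indicator F (circleParam p t θ)) := by
          refine setLIntegral_mono' measurableSet_Icc fun t ht => ?_
          have ht0 : 0 < t := hρ.trans_le ht.1
          have hsub : sphere p t ⊆ closedBall p (2 * ρ) :=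
            sphere_subset_closedBall.trans (closedBall_subset_closedBall ht.2)
          obtain ⟨x, hx, y, hy, hxy⟩ := hcon t ht
          have hkey := sq_div_le_integral_norm_fderiv_sq_circle hUo hw ht0 hd.le
            (hsub.trans hU) hx hy hxy
          have hFc : Continuous fun θ => t * F (circleParam p t θ) :=
            continuous_const.mul (hF.comp_continuous (continuous_circleParam_angle p t)
              fun θ => hU (hsub (circleParam_mem_sphere p ht0.le θ)))
          rw [intervalIntegral.integral_of_le (by linarith), integral_Ioc_eq_integral_Ioo] at hkey
          calc ENNReal.ofReal (d ^ 2 / (4 * Real.pi * ρ))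
              ≤ ENNReal.ofReal (∫ θ in Ioo (-Real.pi) Real.pi, t * F (circleParam p t θ)) := by
                refine ENNReal.ofReal_le_ofReal (le_trans ?_ hkey)
                have h2 := ht.2
                refine div_le_div_of_nonneg_left (by positivity) (by positivity) ?_
                nlinarith
            _ = ∫⁻ θ in Ioo (-Real.pi) Real.pi, ENNReal.ofReal (t * F (circleParam p t θ)) := by
                refine ofReal_integral_eq_lintegral_ofReal
                  (hFc.continuousOn.integrableOn_Icc.mono_set Ioo_subset_Icc_self)
                  (.of_forall fun θ => mul_nonneg ht0.le (sq_nonneg _))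
            _ = _ := by
                refine lintegral_congr fun θ => ?_
                rw [indicator_of_mem (hsub (circleParam_mem_sphere p ht0.le θ))]
      _ = ∫⁻ q in Icc ρ (2 * ρ) ×ˢ Ioo (-Real.pi) Real.pi, ENNReal.ofReal
            (q.1 * (closedBall p (2 * ρ)).indicator F (circleParam p q.1 q.2)) := by
          rw [Measure.volume_eq_prod, ← Measure.prod_restrict,
            lintegral_prod _ hmeas.aemeasurable]
      _ ≤ ∫⁻ q in polarCoord.target, ENNReal.ofReal
            (q.1 * (closedBall p (2 * ρ)).indicator F (circleParam p q.1 q.2)) := by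
          refine lintegral_mono_set ?_
          rw [polarCoord_target]
          exact prod_mono (fun t ht => hρ.trans_le ht.1) subset_rfl
      _ = _ := by
          refine setLIntegral_congr_fun polarCoord.open_target.measurableSet fun q hq => ?_
          have hq0 : 0 < q.1 := by
            rw [polarCoord_target] at hq
            exact hq.1
          have hc : p + complexIsometry (Complex.polarCoord.symm q) = circleParam p q.1 q.2 := by
            rw [circleParam, Complex.polarCoord_symm_apply, Complex.exp_mul_I,
              Complex.ofReal_cos, Complex.ofReal_sin]
          simp only [hc]
          rw [ENNReal.ofReal_mul hq0.le]
          congr 1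
          by_cases hm : circleParam p q.1 q.2 ∈ closedBall p (2 * ρ)
          · rw [indicator_of_mem hm, indicator_of_mem hm]
          · rw [indicator_of_notMem hm, indicator_of_notMem hm, ENNReal.ofReal_zero]
  rw [← ofReal_integral_eq_lintegral_ofReal hFi (.of_forall fun x => sq_nonneg _),
    ENNReal.ofReal_le_ofReal_iff (integral_nonneg fun x => sq_nonneg _)] at hlow
  exact absurd hE hlow.not_gt

/-- Solutions with small Dirichlet energy on a disc have small oscillation on the concentric disc
of half the radius. -/
lemma IsDivergenceFormSolution.abs_sub_lt_of_energy_lt {c : ℝ} {U : Set ℝ²} {w : ℝ² → ℝ}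
    {X : ℝ² → ℝ²} (h : IsDivergenceFormSolution c U w X) {p : ℝ²} {ρ d : ℝ} (hρ : 0 < ρ)
    (hd : 0 < d) (hU : closedBall p (2 * ρ) ⊆ U)
    (hE : ∫ x in closedBall p (2 * ρ), ‖fderiv ℝ w x‖ ^ 2 < d ^ 2 / (4 * Real.pi))
    {x : ℝ²} (hx : x ∈ closedBall p ρ) : |w x - w p| < 2 * d := by
  obtain ⟨t, ht, hosc⟩ := exists_sphere_forall_abs_sub_lt h.isOpen h.contDiffOn hρ hd hU hE
  have ht0 : 0 < t := hρ.trans_le ht.1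
  have hUt : closedBall p t ⊆ U := (closedBall_subset_closedBall ht.2).trans hU
  obtain ⟨z, hz⟩ : (sphere p t).Nonempty := ⟨_, circleParam_mem_sphere p ht0.le 0⟩
  obtain ⟨d', hd', hosc'⟩ : ∃ d' < d, ∀ y ∈ sphere p t, |w y - w z| ≤ d' := by
    obtain ⟨y₀, hy₀, hmax⟩ := (isCompact_sphere p t).exists_isMaxOn ⟨z, hz⟩
      (((h.contDiffOn.continuousOn.mono (sphere_subset_closedBall.trans hUt)).sub
        continuousOn_const).abs : ContinuousOn (fun y => |w y - w z|) (sphere p t))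
    exact ⟨_, hosc y₀ hy₀ z hz, fun y hy => hmax hy⟩
  have hup := h.le_of_le_on_sphere hUt (M := w z + d')
    fun y hy => by linarith [(abs_le.1 (hosc' y hy)).2]
  have hlo := h.neg.le_of_le_on_sphere hUt (M := -w z + d')
    fun y hy => by simpa using by linarith [(abs_le.1 (hosc' y hy)).1]
  have hxt : x ∈ closedBall p t := closedBall_subset_closedBall ht.1 hx
  have hpt : p ∈ closedBall p t := mem_closedBall_self ht0.le
  have h1 := hup x hxt
  have h2 := hup p hpt
  have h3 := hlo x hxt
  have h4 := hlo p hpt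
  simp only [Pi.neg_apply] at h3 h4
  rw [abs_lt]
  constructor <;> linarith

namespace IsDivergenceFormSolution

variable {c r L : ℝ} {w : ℝ² → ℝ} {X : ℝ² → ℝ²}

/-- Bounded solutions in an exterior domain have finite Dirichlet energy near infinity. -/
lemma integrableOn_norm_fderiv_sq (h : IsDivergenceFormSolution c {x | r < ‖x‖} w X)
    (hr : 0 < r) (hL : 0 ≤ L) (hw : ∀ x ∈ {x | r < ‖x‖}, |w x| ≤ L) :
    IntegrableOn (fun x => ‖fderiv ℝ w x‖ ^ 2) {x | r + 2 ≤ ‖x‖} := by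
  let ψ : ContDiffBump (0 : ℝ²) := ⟨1, 2, one_pos, one_lt_two⟩
  let χ : ContDiffBump (0 : ℝ²) := ⟨r + 1, r + 2, by linarith, by linarith⟩
  have hψ : ContDiff ℝ 1 ψ := ψ.contDiff
  have hχ : ContDiff ℝ 1 χ := χ.contDiff
  set S : Set ℝ² := {x | r + 2 ≤ ‖x‖}
  have hS : IsClosed S := isClosed_le continuous_const continuous_norm
  have hdw := h.contDiffOn.continuousOn_fderiv_of_isOpen h.isOpen le_rfl
  have hsqint : ∀ {f : ℝ² → ℝ}, ContDiff ℝ 1 f → HasCompactSupport f →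
      Integrable fun x => ‖fderiv ℝ f x‖ ^ 2 := fun {f} hf hc => by
    refine Continuous.integrable_of_hasCompactSupport
      ((hf.continuous_fderiv one_ne_zero).norm.pow 2) ?_
    refine (hc.fderiv ℝ).mono' fun x hx => subset_tsupport _ fun h0 => hx ?_
    simp [h0]
  set A := ∫ x, ‖fderiv ℝ ψ x‖ ^ 2
  set B := ∫ x, ‖fderiv ℝ χ x‖ ^ 2
  have hbound : ∀ n : ℕ, ∫ x in closedBall 0 (n + 1 : ℝ), ‖fderiv ℝ w x‖ ^ 2 ∂volume.restrict S
      ≤ 4 * L ^ 2 / c ^ 2 * (2 * A + 2 * B) := by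
    intro n
    set R : ℝ := n + 1
    have hR : 0 < R := by positivity
    set ψR : ℝ² → ℝ := fun x => ψ (R⁻¹ • x)
    have hψR : ContDiff ℝ 1 ψR := hψ.comp (contDiff_const_smul _)
    have hψRc : HasCompactSupport ψR := ψ.hasCompactSupport.comp_smul (inv_ne_zero hR.ne')
    have hdψR : ∀ x, ‖fderiv ℝ ψR x‖ ^ 2 = (R⁻¹) ^ 2 * ‖fderiv ℝ ψ (R⁻¹ • x)‖ ^ 2 := fun x => by
      simp only [ψR]
      rw [fderiv_comp_smul, norm_smul, Real.norm_of_nonneg (inv_nonneg.2 hR.le), mul_pow]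
    have hA : ∫ x, ‖fderiv ℝ ψR x‖ ^ 2 = A := by
      simp only [hdψR]
      rw [integral_const_mul,
        Measure.integral_comp_inv_smul_of_nonneg volume (fun x => ‖fderiv ℝ ψ x‖ ^ 2) hR.le,
        finrank_euclideanSpace_fin, smul_eq_mul, ← mul_assoc, ← mul_pow, inv_mul_cancel₀ hR.ne',
        one_pow, one_mul]
    set φ : ℝ² → ℝ := fun x => ψR x * (1 - χ x)
    have hφ : ContDiff ℝ 1 φ := hψR.mul (contDiff_const.sub hχ)
    have hφc : HasCompactSupport φ := hψRc.mul_right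
    have hφs : tsupport φ ⊆ {x | r < ‖x‖} := by
      have h1 : tsupport φ ⊆ {x | r + 1 ≤ ‖x‖} := by
        refine closure_minimal (fun x hx => ?_) (isClosed_le continuous_const continuous_norm)
        by_contra hn
        refine hx ?_
        have : χ x = 1 := χ.one_of_mem_closedBall
          (mem_closedBall_zero_iff.2 (le_of_not_ge hn))
        simp [φ, this]
      exact h1.trans fun x hx => by
        have : r + 1 ≤ ‖x‖ := hx
        exact (lt_add_one r).trans_le this
    obtain ⟨hint, hle⟩ := h.integral_sq_mul_norm_fderiv_sq_le hL hw hφ hφc hφs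
    have hdφ : ∀ x, ‖fderiv ℝ φ x‖ ^ 2 ≤ 2 * ‖fderiv ℝ ψR x‖ ^ 2 + 2 * ‖fderiv ℝ χ x‖ ^ 2 := by
      intro x
      have h1 : HasFDerivAt φ _ x := (hψR.differentiable one_ne_zero x).hasFDerivAt.mul
        ((hχ.differentiable one_ne_zero x).hasFDerivAt.const_sub 1)
      have h2 : ‖fderiv ℝ φ x‖ ≤ ‖fderiv ℝ ψR x‖ + ‖fderiv ℝ χ x‖ := by
        rw [h1.fderiv]
        refine (norm_add_le _ _).trans ?_
        rw [norm_smul, norm_smul, norm_neg, add_comm, Real.norm_eq_abs, Real.norm_eq_abs,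
          abs_of_nonneg (show 0 ≤ ψR x from ψ.nonneg),
          abs_of_nonneg (sub_nonneg.2 χ.le_one)]
        have h3 : ψR x ≤ 1 := ψ.le_one
        have h4 : 1 - χ x ≤ 1 := sub_le_self _ χ.nonneg
        exact add_le_add (mul_le_of_le_one_left (norm_nonneg _) h4)
          (mul_le_of_le_one_left (norm_nonneg _) h3)
      nlinarith [norm_nonneg (fderiv ℝ φ x), sq_nonneg (‖fderiv ℝ ψR x‖ - ‖fderiv ℝ χ x‖)]
    have hφen : ∫ x, ‖fderiv ℝ φ x‖ ^ 2 ≤ 2 * A + 2 * B := by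
      have i1 := (hsqint hψR hψRc).const_mul 2
      have i2 := (hsqint hχ χ.hasCompactSupport).const_mul 2
      refine (integral_mono (hsqint hφ hφc) (i1.add i2) hdφ).trans_eq ?_
      simp only [Pi.add_apply]
      rw [integral_add i1 i2, integral_const_mul, integral_const_mul, hA]
    rw [Measure.restrict_restrict measurableSet_closedBall]
    calc ∫ x in closedBall 0 R ∩ S, ‖fderiv ℝ w x‖ ^ 2
        = ∫ x in closedBall 0 R ∩ S, φ x ^ 2 * ‖fderiv ℝ w x‖ ^ 2 := by
          refine setIntegral_congr_fun (measurableSet_closedBall.inter hS.measurableSet)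
            fun x hx => ?_
          have h1 : χ x = 0 := χ.zero_of_le_dist (by rw [dist_zero_right]; exact hx.2)
          have h2 : ψR x = 1 := by
            refine ψ.one_of_mem_closedBall ?_
            have := mem_closedBall_zero_iff.1 hx.1
            rw [mem_closedBall_zero_iff, norm_smul, Real.norm_of_nonneg (inv_nonneg.2 hR.le)]
            exact inv_mul_le_one_of_le₀ this hR.le
          simp [φ, h1, h2]
      _ ≤ ∫ x, φ x ^ 2 * ‖fderiv ℝ w x‖ ^ 2 :=
          setIntegral_le_integral hint (.of_forall fun x => by positivity)
      _ ≤ _ := hle.trans (mul_le_mul_of_nonneg_left hφen (by positivity))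
  have hcover : AECover (volume.restrict S) atTop fun n : ℕ => closedBall (0 : ℝ²) (n + 1 : ℝ) :=
    (aecover_closedBall (tendsto_atTop_add_const_right _ _ tendsto_natCast_atTop_atTop)).restrict
  refine hcover.integrable_of_integral_bounded_of_nonneg_ae _ (fun n => ?_)
    (.of_forall fun x => sq_nonneg _) (.of_forall hbound)
  rw [IntegrableOn, Measure.restrict_restrict measurableSet_closedBall]
  refine ContinuousOn.integrableOn_compact ((isCompact_closedBall _ _).inter_right hS) ?_
  refine (hdw.norm.pow 2).mono fun x hx => ?_
  have : r + 2 ≤ ‖x‖ := hx.2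
  change r < ‖x‖
  linarith

/-- The oscillation of a bounded exterior solution on the disc of radius `‖p‖ / 8` around `p`
tends to zero as `p` tends to infinity. -/
lemma exists_forall_abs_sub_lt (h : IsDivergenceFormSolution c {x | r < ‖x‖} w X)
    (hr : 0 < r) (hL : 0 ≤ L) (hw : ∀ x ∈ {x | r < ‖x‖}, |w x| ≤ L) {d : ℝ} (hd : 0 < d) :
    ∃ R, ∀ p : ℝ², R ≤ ‖p‖ → ∀ x ∈ closedBall p (‖p‖ / 8), |w x - w p| < d := by
  have hint := h.integrableOn_norm_fderiv_sq hr hL hw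
  set F : ℝ² → ℝ := fun x => ‖fderiv ℝ w x‖ ^ 2
  set s : ℕ → Set ℝ² := fun n => {x | r + 2 + n ≤ ‖x‖}
  have hs0 : ∀ n, s n ⊆ {x | r + 2 ≤ ‖x‖} := fun n x hx => by
    have : r + 2 + n ≤ ‖x‖ := hx
    change r + 2 ≤ ‖x‖
    linarith [n.cast_nonneg (α := ℝ)]
  have hanti : Antitone s := fun m n hmn x hx => by
    have : r + 2 + n ≤ ‖x‖ := hx
    change r + 2 + m ≤ ‖x‖
    linarith [(Nat.cast_le (α := ℝ)).2 hmn]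
  have hmeas : ∀ n, MeasurableSet (s n) := fun n =>
    (isClosed_le continuous_const continuous_norm).measurableSet
  have hinter : ⋂ n, s n = ∅ := by
    refine eq_empty_of_forall_notMem fun x hx => ?_
    obtain ⟨n, hn⟩ := exists_nat_gt ‖x‖
    have : r + 2 + n ≤ ‖x‖ := mem_iInter.1 hx n
    linarith
  have hlim := tendsto_setIntegral_of_antitone (f := F) hmeas hanti
    ⟨0, hint.mono_set (hs0 0)⟩
  rw [hinter, setIntegral_empty] at hlim
  obtain ⟨n, hn⟩ := (hlim.eventually_lt_const
    (show (0 : ℝ) < (d / 2) ^ 2 / (4 * Real.pi) by have := Real.pi_pos; positivity)).exists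
  refine ⟨2 * (r + 2 + n), fun p hp x hx => ?_⟩
  have hn0 : (0 : ℝ) ≤ n := n.cast_nonneg
  have hsub : closedBall p (2 * (‖p‖ / 8)) ⊆ s n := fun y hy => by
    have h1 : ‖y - p‖ ≤ 2 * (‖p‖ / 8) := mem_closedBall_iff_norm.1 hy
    have h2 := norm_sub_norm_le p y
    rw [norm_sub_rev] at h2
    change r + 2 + n ≤ ‖y‖
    linarith
  have hE : ∫ x in closedBall p (2 * (‖p‖ / 8)), F x < (d / 2) ^ 2 / (4 * Real.pi) :=
    (setIntegral_mono_set (hint.mono_set (hs0 n)) (.of_forall fun x => sq_nonneg _)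
      hsub.eventuallyLE).trans_lt hn
  have := h.abs_sub_lt_of_energy_lt (by linarith) (half_pos hd)
    (hsub.trans fun y hy => by
      have : r + 2 + n ≤ ‖y‖ := hy
      change r < ‖y‖
      linarith) hE hx
  linarith

end IsDivergenceFormSolution

lemma norm_sq_eq_sum_sq_single (f : ℝ² →L[ℝ] ℝ) :
    ‖f‖ ^ 2 = ∑ i, f (EuclideanSpace.single i 1) ^ 2 := by
  set v := (InnerProductSpace.toDual ℝ ℝ²).symm f
  have hv : ∀ i, f (EuclideanSpace.single i 1) = v i := fun i => by
    rw [← InnerProductSpace.toDual_symm_apply (𝕜 := ℝ), EuclideanSpace.inner_single_right]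
    simp [v]
  have hn : ‖f‖ = ‖v‖ := ((InnerProductSpace.toDual ℝ ℝ²).symm.norm_map f).symm
  rw [hn, EuclideanSpace.norm_sq_eq]
  simp only [hv, Real.norm_eq_abs, sq_abs]

lemma ContDiffOn.pderiv2_of_isOpen {U : Set ℝ²} (hU : IsOpen U) {f : ℝ² → ℝ}
    (hf : ContDiffOn ℝ (⊤ : ℕ∞) f U) (i : Fin 2) : ContDiffOn ℝ (⊤ : ℕ∞) (pderiv2 f i) U :=
  (hf.fderiv_of_isOpen hU (by simp)).clm_apply contDiffOn_const

lemma pderiv2_comm {f : ℝ² → ℝ} {x : ℝ²} (hf : ContDiffAt ℝ 2 f x) (i j : Fin 2) :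
    pderiv2 (pderiv2 f i) j x = pderiv2 (pderiv2 f j) i x := by
  have hd : DifferentiableAt ℝ (fderiv ℝ f) x :=
    (hf.fderiv_right (m := 1) (by norm_num)).differentiableAt one_ne_zero
  have key : ∀ i j, pderiv2 (pderiv2 f i) j x =
      fderiv ℝ (fderiv ℝ f) x (EuclideanSpace.single j 1) (EuclideanSpace.single i 1) := by
    intro i j
    have h1 : HasFDerivAt (pderiv2 f i) _ x :=
      hd.hasFDerivAt.clm_apply (hasFDerivAt_const (EuclideanSpace.single i (1 : ℝ)) x)
    rw [pderiv2, h1.fderiv]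
    simp
  rw [key, key]
  exact (hf.isSymmSndFDerivAt (by simp)) _ _

/-- The area density `√(1 + ‖∇u‖²)` of the graph of `u`. -/
def graphDensity (u : ℝ² → ℝ) (x : ℝ²) : ℝ := √(1 + pderiv2 u 0 x ^ 2 + pderiv2 u 1 x ^ 2)

/-- The components of the vector field `∇u / √(1 + ‖∇u‖²)`. -/
def graphFlux (u : ℝ² → ℝ) (i : Fin 2) (x : ℝ²) : ℝ := pderiv2 u i x / graphDensity u x

lemma graphDensity_pos (u : ℝ² → ℝ) (x : ℝ²) : 0 < graphDensity u x :=
  Real.sqrt_pos.2 (by positivity)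

lemma graphDensity_sq (u : ℝ² → ℝ) (x : ℝ²) :
    graphDensity u x ^ 2 = 1 + pderiv2 u 0 x ^ 2 + pderiv2 u 1 x ^ 2 :=
  Real.sq_sqrt (by positivity)

lemma ContDiffOn.graphFlux {U : Set ℝ²} (hU : IsOpen U) {u : ℝ² → ℝ}
    (hu : ContDiffOn ℝ (⊤ : ℕ∞) u U) (i : Fin 2) : ContDiffOn ℝ (⊤ : ℕ∞) (graphFlux u i) U := by
  refine (hu.pderiv2_of_isOpen hU i).div (ContDiffOn.sqrt ?_ fun x _ => ?_)
    fun x _ => (graphDensity_pos u x).ne'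
  · exact (contDiffOn_const.add ((hu.pderiv2_of_isOpen hU 0).pow 2)).add
      ((hu.pderiv2_of_isOpen hU 1).pow 2)
  · positivity

lemma pderiv2_graphFlux {u : ℝ² → ℝ} {x : ℝ²} (hd : ∀ i, DifferentiableAt ℝ (pderiv2 u i) x)
    (i k : Fin 2) : pderiv2 (graphFlux u i) k x =
      (graphDensity u x ^ 2 * pderiv2 (pderiv2 u i) k x - pderiv2 u i x *
        (pderiv2 u 0 x * pderiv2 (pderiv2 u 0) k x + pderiv2 u 1 x * pderiv2 (pderiv2 u 1) k x))
        / graphDensity u x ^ 3 := by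
  have hW := graphDensity_pos u x
  have h1 : HasFDerivAt (fun y => 1 + pderiv2 u 0 y ^ 2 + pderiv2 u 1 y ^ 2) _ x :=
    (((hd 0).hasFDerivAt.pow 2).const_add 1).add ((hd 1).hasFDerivAt.pow 2)
  have h2 : HasFDerivAt (graphDensity u) _ x := h1.sqrt (by positivity)
  have h3 : HasFDerivAt (fun y => pderiv2 u i y * (graphDensity u y)⁻¹) _ x :=
    (hd i).hasFDerivAt.mul ((hasDerivAt_inv hW.ne').comp_hasFDerivAt x h2)
  have hflux : graphFlux u i = fun y => pderiv2 u i y * (graphDensity u y)⁻¹ :=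
    funext fun y => div_eq_mul_inv _ _
  have hWdef : √(1 + pderiv2 u 0 x ^ 2 + pderiv2 u 1 x ^ 2) = graphDensity u x := rfl
  rw [pderiv2, hflux, h3.fderiv, hWdef]
  simp only [pderiv2, smul_apply, add_apply, smul_eq_mul, nsmul_eq_mul]
  field_simp
  ring

/-- Each partial derivative of a solution of the minimal surface equation with bounded gradient
solves the linearised equation, which is uniformly elliptic of divergence form. -/
lemma MinimalSurfaceEquation.isDivergenceFormSolution_pderiv2 {u : ℝ² → ℝ} {U : Set ℝ²} {L : ℝ}
    (hu : MinimalSurfaceEquation u U) (hU : IsOpen U) (hsmooth : ContDiffOn ℝ (⊤ : ℕ∞) u U)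
    (hgrad : ∀ x ∈ U, ‖fderiv ℝ u x‖ ≤ L) (k : Fin 2) :
    IsDivergenceFormSolution (√(1 + L ^ 2) ^ 3)⁻¹ U (pderiv2 u k)
      (fun x => WithLp.toLp 2 fun i => pderiv2 (graphFlux u i) k x) := by
  have hd : ∀ i, ∀ x ∈ U, DifferentiableAt ℝ (pderiv2 u i) x := fun i x hx =>
    ((hsmooth.pderiv2_of_isOpen hU i).contDiffAt (hU.mem_nhds hx)).differentiableAt (by simp)
  have hu2 : ∀ x ∈ U, ContDiffAt ℝ 2 u x := fun x hx =>
    (hsmooth.contDiffAt (hU.mem_nhds hx)).of_le (by norm_cast)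
  have hF2 : ∀ i, ∀ x ∈ U, ContDiffAt ℝ 2 (graphFlux u i) x := fun i x hx =>
    ((hsmooth.graphFlux hU i).contDiffAt (hU.mem_nhds hx)).of_le (by norm_cast)
  have hnorm : ∀ x ∈ U, ‖fderiv ℝ (pderiv2 u k) x‖ ^ 2
      = pderiv2 (pderiv2 u 0) k x ^ 2 + pderiv2 (pderiv2 u 1) k x ^ 2 := fun x hx => by
    rw [norm_sq_eq_sum_sq_single, Fin.sum_univ_two, pderiv2_comm (hu2 x hx) 0 k,
      pderiv2_comm (hu2 x hx) 1 k]
    rfl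
  have hdiv : ∀ x ∈ U, pderiv2 (graphFlux u 0) 0 x + pderiv2 (graphFlux u 1) 1 x = 0 := by
    intro x hx
    have hW := graphDensity_pos u x
    rw [pderiv2_graphFlux (hd · x hx), pderiv2_graphFlux (hd · x hx), ← add_div,
      div_eq_zero_iff, graphDensity_sq, pderiv2_comm (hu2 x hx) 0 1]
    left
    linear_combination hu.2 x hx
  refine ⟨hU, by positivity, (hsmooth.pderiv2_of_isOpen hU k).of_le (by exact_mod_cast le_top),
    ?_, ?_, ?_, ?_⟩
  · refine contDiffOn_euclidean.2 fun i => ?_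
    exact ((hsmooth.graphFlux hU i).pderiv2_of_isOpen hU k).of_le (by exact_mod_cast le_top)
  · intro x hx
    have hdF : ∀ i, DifferentiableAt ℝ (pderiv2 (graphFlux u i) i) x := fun i =>
      (((hsmooth.graphFlux hU i).pderiv2_of_isOpen hU i).contDiffAt
        (hU.mem_nhds hx)).differentiableAt (by simp)
    have h0 : (fun y => pderiv2 (graphFlux u 0) 0 y + pderiv2 (graphFlux u 1) 1 y)
        =ᶠ[𝓝 x] fun _ => 0 := by
      filter_upwards [hU.mem_nhds hx] with y hy using hdiv y hy
    have h1 := h0.fderiv_eq (𝕜 := ℝ)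
    rw [((hdF 0).hasFDerivAt.fun_add (hdF 1).hasFDerivAt).fderiv, fderiv_fun_const] at h1
    have h2 := congrArg (fun f : ℝ² →L[ℝ] ℝ => f (EuclideanSpace.single k 1)) h1
    rw [Fin.sum_univ_two]
    change pderiv2 (pderiv2 (graphFlux u 0) k) 0 x + pderiv2 (pderiv2 (graphFlux u 1) k) 1 x = 0
    rw [pderiv2_comm (hF2 0 x hx), pderiv2_comm (hF2 1 x hx)]
    simpa [pderiv2] using h2
  · intro x hx
    have hW := graphDensity_pos u x
    refine le_of_sq_le_sq ?_ (norm_nonneg _)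
    rw [hnorm x hx, EuclideanSpace.norm_sq_eq, Fin.sum_univ_two]
    simp only [Real.norm_eq_abs, sq_abs]
    rw [pderiv2_graphFlux (hd · x hx), pderiv2_graphFlux (hd · x hx)]
    have hW2 := graphDensity_sq u x
    set W := graphDensity u x
    set a := pderiv2 (pderiv2 u 0) k x
    set b := pderiv2 (pderiv2 u 1) k x
    set p := pderiv2 u 0 x
    set q := pderiv2 u 1 x
    rw [div_pow, div_pow, ← add_div, div_le_iff₀ (by positivity)]
    have hid : (W ^ 2 * a - p * (p * a + q * b)) ^ 2 + (W ^ 2 * b - q * (p * a + q * b)) ^ 2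
        = (W ^ 2) ^ 2 * (a ^ 2 + b ^ 2) - (W ^ 2 + 1) * (p * a + q * b) ^ 2 := by
      rw [hW2]
      ring
    have h1 : 0 ≤ (W ^ 2 + 1) * (p * a + q * b) ^ 2 := by positivity
    have h2 : 0 ≤ (W ^ 2) ^ 2 * (W ^ 2 - 1) * (a ^ 2 + b ^ 2) := by
      have : 0 ≤ W ^ 2 - 1 := by rw [hW2]; nlinarith [sq_nonneg p, sq_nonneg q]
      positivity
    rw [hid]
    nlinarith
  · intro x hx
    have hW := graphDensity_pos u x
    rw [hnorm x hx, clm_apply_eq_sum_single, Fin.sum_univ_two]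
    change _ ≤ pderiv2 (pderiv2 u k) 0 x * pderiv2 (graphFlux u 0) k x
      + pderiv2 (pderiv2 u k) 1 x * pderiv2 (graphFlux u 1) k x
    rw [pderiv2_graphFlux (hd · x hx), pderiv2_graphFlux (hd · x hx),
      pderiv2_comm (hu2 x hx) k 0, pderiv2_comm (hu2 x hx) k 1]
    have hW2 := graphDensity_sq u x
    have hWL : graphDensity u x ≤ √(1 + L ^ 2) := by
      refine Real.sqrt_le_sqrt ?_
      have h1 : ‖fderiv ℝ u x‖ ^ 2 ≤ L ^ 2 := by
        have := hgrad x hx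
        gcongr
      rw [norm_sq_eq_sum_sq_single, Fin.sum_univ_two] at h1
      simp only [pderiv2]
      linarith
    set W := graphDensity u x
    set a := pderiv2 (pderiv2 u 0) k x
    set b := pderiv2 (pderiv2 u 1) k x
    set p := pderiv2 u 0 x
    set q := pderiv2 u 1 x
    calc (√(1 + L ^ 2) ^ 3)⁻¹ * (a ^ 2 + b ^ 2) ≤ (W ^ 3)⁻¹ * (a ^ 2 + b ^ 2) := by gcongr
      _ ≤ (W ^ 3)⁻¹ * (W ^ 2 * (a ^ 2 + b ^ 2) - (p * a + q * b) ^ 2) := by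
          gcongr
          rw [hW2]
          nlinarith [sq_nonneg (p * b - q * a)]
      _ = _ := by
          field_simp
          ring

lemma norm_gradient (u : ℝ² → ℝ) (x : ℝ²) : ‖gradient u x‖ = ‖fderiv ℝ u x‖ :=
  (InnerProductSpace.toDual ℝ ℝ²).symm.norm_map _

lemma exists_unit_orthogonal_inner_nonneg {v : ℝ²} (hv : ‖v‖ = 1) (p : ℝ²) :
    ∃ e : ℝ², ‖e‖ = 1 ∧ inner ℝ v e = 0 ∧ 0 ≤ inner ℝ p e := by
  set e : ℝ² := !₂[-v 1, v 0]
  have he : ‖e‖ = 1 := by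
    have h : ‖e‖ ^ 2 = ‖v‖ ^ 2 := by
      simp only [EuclideanSpace.norm_sq_eq, Fin.sum_univ_two, Real.norm_eq_abs, sq_abs]
      simp [e, add_comm]
    rw [← hv]
    exact (pow_left_inj₀ (norm_nonneg _) (norm_nonneg _) two_ne_zero).1 h
  have hve : inner ℝ v e = 0 := by
    simp only [PiLp.inner_apply, Fin.sum_univ_two]
    simp [e]
    ring
  rcases le_total 0 (inner ℝ p e) with h | h
  · exact ⟨e, he, hve, h⟩
  · exact ⟨-e, by rwa [norm_neg], by rw [inner_neg_right, hve, neg_zero],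
      by rw [inner_neg_right]; linarith⟩

/-- A function with bounded gradient on an exterior region has at most linear decay. -/
lemma exists_forall_sub_le_of_norm_fderiv_le {u : ℝ² → ℝ} {r L : ℝ} (hr : 0 < r) (hL : 0 ≤ L)
    (hd : ∀ x, r < ‖x‖ → DifferentiableAt ℝ u x) (hgrad : ∀ x, r < ‖x‖ → ‖fderiv ℝ u x‖ ≤ L) :
    ∃ C, ∀ x, 2 * r ≤ ‖x‖ → -C - L * ‖x‖ ≤ u x := by
  have hcont : ContinuousOn u (sphere 0 (2 * r)) := fun x hx =>
    (hd x (by rw [mem_sphere_zero_iff_norm.1 hx]; linarith)).continuousAt.continuousWithinAt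
  obtain ⟨C, hC⟩ := (isCompact_sphere (0 : ℝ²) (2 * r)).exists_bound_of_continuousOn hcont
  refine ⟨C, fun x hx => ?_⟩
  have hx0 : 0 < ‖x‖ := by linarith
  set c := 2 * r / ‖x‖
  have hc0 : 0 ≤ c := by positivity
  have hc1 : c ≤ 1 := (div_le_one hx0).2 hx
  have hcx : c * ‖x‖ = 2 * r := div_mul_cancel₀ _ hx0.ne'
  have hseg : ∀ y ∈ segment ℝ (c • x) x, r < ‖y‖ := by
    rintro y ⟨a, b, ha, hb, hab, rfl⟩
    have h1 : a • c • x + b • x = (a * c + b) • x := by rw [add_smul, mul_smul]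
    rw [h1, norm_smul, Real.norm_of_nonneg (by positivity)]
    have h2 : c ≤ a * c + b := by nlinarith
    nlinarith
  have hmv := (convex_segment (c • x) x).norm_image_sub_le_of_norm_hasFDerivWithin_le
    (fun y hy => (hd y (hseg y hy)).hasFDerivAt.hasFDerivWithinAt)
    (fun y hy => hgrad y (hseg y hy)) (left_mem_segment ℝ _ _) (right_mem_segment ℝ _ _)
  have hdist : ‖x - c • x‖ ≤ ‖x‖ := by
    have h1 : x - c • x = (1 - c) • x := by rw [sub_smul, one_smul]
    rw [h1, norm_smul, Real.norm_of_nonneg (by linarith)]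
    nlinarith
  have h0 := hC (c • x) (by
    rw [mem_sphere_zero_iff_norm, norm_smul, Real.norm_of_nonneg hc0, hcx])
  have h2 : L * ‖x - c • x‖ ≤ L * ‖x‖ := by gcongr
  have h3 := neg_le_of_abs_le h0
  have h4 := neg_le_of_abs_le hmv
  linarith

/-- If the differential varies slowly at scale `‖p‖`, then it stays close to its value at `p` on a
ray which leaves a neighbourhood of `p` and remains at distance at least `‖p‖ / 8` from `0`. -/
lemma norm_fderiv_sub_le_of_slowly_varying {u : ℝ² → ℝ} {R d : ℝ} (hd : 0 ≤ d)
    (hslow : ∀ p, R ≤ ‖p‖ → ∀ q ∈ closedBall p (‖p‖ / 8), ‖fderiv ℝ u q - fderiv ℝ u p‖ ≤ d)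
    {p e v : ℝ²} (hp : R ≤ ‖p‖ / 8) (he : ‖e‖ = 1) (hv : ‖v‖ = 1)
    (hray : ∀ t : ℝ, 0 ≤ t → ‖p‖ / 8 ≤ ‖p + (‖p‖ / 8) • e + t • v‖) (n : ℕ) :
    ∀ t : ℝ, 0 ≤ t → t ≤ n * (‖p‖ / 64) →
      ‖fderiv ℝ u (p + (‖p‖ / 8) • e + t • v) - fderiv ℝ u p‖ ≤ (n + 1) * d := by
  have hp0 : 0 ≤ ‖p‖ := norm_nonneg p
  induction n with
  | zero =>
    intro t ht0 ht
    obtain rfl : t = 0 := le_antisymm (by simpa using ht) ht0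
    rw [zero_smul, add_zero]
    refine (hslow p (by linarith) _ ?_).trans_eq (by simp)
    rw [mem_closedBall_iff_norm, add_sub_cancel_left, norm_smul, he, mul_one,
      Real.norm_of_nonneg (by positivity)]
  | succ n ih =>
    intro t ht0 ht
    push_cast at ht ⊢
    rcases le_total t (n * (‖p‖ / 64)) with h | h
    · linarith [ih t ht0 h]
    set t' := n * (‖p‖ / 64)
    have ht' : 0 ≤ t' := by positivity
    have hq := hray t' ht'
    have h1 := ih t' ht' le_rfl
    have h2 := hslow (p + (‖p‖ / 8) • e + t' • v) (hp.trans hq) (p + (‖p‖ / 8) • e + t • v) (by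
      rw [mem_closedBall_iff_norm, add_sub_add_left_eq_sub, ← sub_smul, norm_smul, hv, mul_one,
        Real.norm_of_nonneg (by linarith)]
      have : t - t' ≤ ‖p‖ / 64 := by simp only [t']; linarith
      linarith)
    have h3 := norm_sub_le_norm_sub_add_norm_sub (fderiv ℝ u (p + (‖p‖ / 8) • e + t • v))
      (fderiv ℝ u (p + (‖p‖ / 8) • e + t' • v)) (fderiv ℝ u p)
    linarith

/-- A nonpositive function on an exterior region whose differential is bounded and varies slowly
at infinity has differential tending to zero at infinity. -/
lemma exists_forall_norm_fderiv_lt_of_slowly_varying {u : ℝ² → ℝ} {r L : ℝ} (hr : 0 < r)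
    (hL : 0 ≤ L) (hdiff : ∀ x, r < ‖x‖ → DifferentiableAt ℝ u x)
    (hgrad : ∀ x, r < ‖x‖ → ‖fderiv ℝ u x‖ ≤ L) (hnonpos : ∀ x, r < ‖x‖ → u x ≤ 0)
    (hslow : ∀ d, 0 < d → ∃ R, ∀ p, R ≤ ‖p‖ → ∀ q ∈ closedBall p (‖p‖ / 8),
      ‖fderiv ℝ u q - fderiv ℝ u p‖ ≤ d) {δ : ℝ} (hδ : 0 < δ) :
    ∃ R₀, ∀ p, R₀ ≤ ‖p‖ → ‖fderiv ℝ u p‖ < δ := by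
  obtain ⟨C, hC⟩ := exists_forall_sub_le_of_norm_fderiv_le hr hL hdiff hgrad
  obtain ⟨N, hN⟩ := exists_nat_ge (128 * (2 * L + 1) / δ)
  rw [div_le_iff₀ hδ] at hN
  set d := δ / (2 * (N + 1))
  have hd : 0 < d := by positivity
  have hNd : (N + 1) * d = δ / 2 := by simp only [d]; field_simp
  obtain ⟨R, hR⟩ := hslow d hd
  refine ⟨max (8 * R) (max (16 * r) (C + 1)), fun p hp => ?_⟩
  obtain ⟨hpR, hp⟩ := max_le_iff.1 hp
  obtain ⟨hpr, hpC⟩ := max_le_iff.1 hp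
  by_contra! hlt
  have hg : δ ≤ ‖gradient u p‖ := by rwa [norm_gradient]
  have hg0 : 0 < ‖gradient u p‖ := hδ.trans_le hg
  set v := ‖gradient u p‖⁻¹ • gradient u p
  have hv : ‖v‖ = 1 := by rw [norm_smul, norm_inv, norm_norm, inv_mul_cancel₀ hg0.ne']
  have hpv : fderiv ℝ u p v = ‖gradient u p‖ := by
    rw [← InnerProductSpace.toDual_symm_apply (𝕜 := ℝ)]
    change inner ℝ (gradient u p) v = _
    rw [real_inner_smul_right, real_inner_self_eq_norm_sq]
    field_simp
  obtain ⟨e, he, hve, hpe⟩ := exists_unit_orthogonal_inner_nonneg hv p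
  have hray : ∀ t : ℝ, ‖p‖ / 8 ≤ ‖p + (‖p‖ / 8) • e + t • v‖ := fun t => by
    have h := real_inner_le_norm (p + (‖p‖ / 8) • e + t • v) e
    rw [inner_add_left, inner_add_left, real_inner_smul_left, real_inner_smul_left, hve,
      real_inner_self_eq_norm_sq, he] at h
    linarith
  have hmem : ∀ t : ℝ, r < ‖p + (‖p‖ / 8) • e + t • v‖ := fun t => by linarith [hray t]
  have hderiv : ∀ t : ℝ, HasDerivAt (fun t : ℝ => u (p + (‖p‖ / 8) • e + t • v))
      (fderiv ℝ u (p + (‖p‖ / 8) • e + t • v) v) t := fun t => by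
    refine (hdiff _ (hmem t)).hasFDerivAt.comp_hasDerivAt t ?_
    simpa using ((hasDerivAt_id t).smul_const v).const_add (p + (‖p‖ / 8) • e)
  have hnear := norm_fderiv_sub_le_of_slowly_varying hd.le hR (by linarith) he hv
    (fun t _ => hray t) N
  have hT : 0 ≤ N * (‖p‖ / 64) := by positivity
  have hmv := (convex_Icc 0 (N * (‖p‖ / 64))).mul_sub_le_image_sub_of_le_deriv
    (fun t _ => (hderiv t).continuousAt.continuousWithinAt)
    (fun t _ => (hderiv t).differentiableAt.differentiableWithinAt) (C := δ / 2)
    (fun t ht => by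
      rw [interior_Icc] at ht
      rw [(hderiv t).deriv]
      have h1 := (fderiv ℝ u (p + (‖p‖ / 8) • e + t • v) - fderiv ℝ u p).le_opNorm v
      rw [hv, mul_one, sub_apply, hpv] at h1
      have h2 := neg_le_of_abs_le (h1.trans (hnear t ht.1.le ht.2.le))
      linarith)
    0 ⟨le_rfl, hT⟩ _ ⟨hT, le_rfl⟩ hT
  rw [zero_smul, add_zero, sub_zero] at hmv
  have h1 := hray 0
  rw [zero_smul, add_zero] at h1
  have h2 := hC (p + (‖p‖ / 8) • e) (by linarith)
  have h3 : ‖p + (‖p‖ / 8) • e‖ ≤ 2 * ‖p‖ := by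
    have h := norm_add_le p ((‖p‖ / 8) • e)
    rw [norm_smul, he, mul_one, Real.norm_of_nonneg (by positivity)] at h
    linarith [norm_nonneg p]
  have h4 : L * ‖p + (‖p‖ / 8) • e‖ ≤ L * (2 * ‖p‖) := by gcongr
  have h5 := hnonpos _ (hmem (N * (‖p‖ / 64)))
  have h6 : 128 * (2 * L + 1) * ‖p‖ ≤ N * δ * ‖p‖ := by gcongr
  linarith

/-- The differential of a minimal graph with bounded gradient over an exterior region varies
slowly at infinity. -/
lemma MinimalSurfaceEquation.exists_forall_norm_fderiv_sub_le {u : ℝ² → ℝ} {r L : ℝ} (hr : 0 < r)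
    (hL : 0 ≤ L) (hsmooth : ContDiffOn ℝ (⊤ : ℕ∞) u {x | r < ‖x‖})
    (hu : MinimalSurfaceEquation u {x | r < ‖x‖})
    (hgrad : ∀ x, r < ‖x‖ → ‖fderiv ℝ u x‖ ≤ L) {d : ℝ} (hd : 0 < d) :
    ∃ R, ∀ p, R ≤ ‖p‖ → ∀ q ∈ closedBall p (‖p‖ / 8), ‖fderiv ℝ u q - fderiv ℝ u p‖ ≤ d := by
  have hU : IsOpen {x : ℝ² | r < ‖x‖} := isOpen_lt continuous_const continuous_norm
  have hosc : ∀ k, ∃ R, ∀ p, R ≤ ‖p‖ → ∀ q ∈ closedBall p (‖p‖ / 8),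
      |pderiv2 u k q - pderiv2 u k p| < d / 2 := fun k => by
    refine (hu.isDivergenceFormSolution_pderiv2 hU hsmooth hgrad k).exists_forall_abs_sub_lt hr hL
      (fun x hx => ?_) (half_pos hd)
    have h := (fderiv ℝ u x).le_opNorm (EuclideanSpace.single k 1)
    rw [PiLp.norm_single, norm_one, mul_one] at h
    exact h.trans (hgrad x hx)
  choose R hR using hosc
  refine ⟨max (R 0) (R 1), fun p hp q hq => abs_le_of_sq_le_sq' ?_ hd.le |>.2⟩
  rw [norm_sq_eq_sum_sq_single, Fin.sum_univ_two]
  have h0 := sq_lt_sq' (neg_lt_of_abs_lt (hR 0 p (le_of_max_le_left hp) q hq))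
    (lt_of_abs_lt (hR 0 p (le_of_max_le_left hp) q hq))
  have h1 := sq_lt_sq' (neg_lt_of_abs_lt (hR 1 p (le_of_max_le_right hp) q hq))
    (lt_of_abs_lt (hR 1 p (le_of_max_le_right hp) q hq))
  simp only [pderiv2] at h0 h1
  simp only [sub_apply]
  nlinarith

/-- A minimal graph over an exterior region `{‖p‖ > r}` in `ℝ²` with uniformly
bounded gradient and contained in the halfspace `{z ≤ 0}` is horizontal at infinity: its
gradient tends to zero as `‖p‖ → ∞`. -/
theorem exterior_minimal_graph_nonpositive_gradient_tendsto_zero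
    (r L : ℝ) (hr : 0 < r) (hL : 0 ≤ L)
    (u : EuclideanSpace ℝ (Fin 2) → ℝ)
    (hsmooth : ContDiffOn ℝ (⊤ : ℕ∞) u {p : EuclideanSpace ℝ (Fin 2) | r < ‖p‖})
    (hmse : MinimalSurfaceEquation u {p : EuclideanSpace ℝ (Fin 2) | r < ‖p‖})
    (hgrad : ∀ p : EuclideanSpace ℝ (Fin 2), r < ‖p‖ → ‖gradient u p‖ ≤ L)
    (hnonpos : ∀ p : EuclideanSpace ℝ (Fin 2), r < ‖p‖ → u p ≤ 0) :
    ∀ δ : ℝ, 0 < δ → ∃ R₀ : ℝ,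
      ∀ p : EuclideanSpace ℝ (Fin 2), R₀ ≤ ‖p‖ → ‖gradient u p‖ < δ := by
  have hgrad' : ∀ x : ℝ², r < ‖x‖ → ‖fderiv ℝ u x‖ ≤ L := fun x hx => by
    rw [← norm_gradient]
    exact hgrad x hx
  have hU : IsOpen {x : ℝ² | r < ‖x‖} := isOpen_lt continuous_const continuous_norm
  intro δ hδ
  simp only [norm_gradient]
  exact exists_forall_norm_fderiv_lt_of_slowly_varying hr hL
    (fun x hx => (hsmooth.contDiffAt (hU.mem_nhds hx)).differentiableAt (by simp)) hgrad' hnonpos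
    (fun d hd => hmse.exists_forall_norm_fderiv_sub_le hr hL hsmooth hgrad' hd) hδ
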